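/- Let d ≥ 2 and let u_1, …, u_d, v_1, …, v_d ∈ ℝ[x] be nonconstant polynomials of degree at most δ. Then there exists a constant c > 0 depending only on δ and d such that for all n ∈ ℕ and all finite sets A_1, …, A_d ⊂ ℝ with |A_i| = n for each i, |u_1(A_1) + ⋯ + u_d(A_d)| · |v_1(A_1) · … · v_d(A_d)| ≥ c · n^{3 − 1/2^{d−1}}, where u_1(A_1) + ⋯ + u_d(A_d) := {u_1(a_1) + ⋯ + u_d(a_d) : a_i ∈ A_i} and v_1(A_1) · … · v_d(A_d) := {v_1(a_1) · … · v_d(a_d) : a_i ∈ A_i}. -/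

import Mathlib

open Polynomial Pointwise

noncomputable section

/-- A complex polynomial divided by its leading power tends to the leading coefficient. -/
lemma poly_div_pow_tendsto (p : ℂ[X]) :
    Filter.Tendsto (fun z : ℂ => p.eval z / z ^ p.natDegree) (Bornology.cobounded ℂ)
      (nhds p.leadingCoeff) := by
  have h1 : Filter.Tendsto (fun z : ℂ => p.reverse.eval z⁻¹) (Bornology.cobounded ℂ)
      (nhds (p.reverse.eval 0)) :=
    (p.reverse.continuous.tendsto 0).comp Filter.tendsto_inv₀_cobounded
  have h2 : p.reverse.eval 0 = p.leadingCoeff := by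
    rw [← coeff_zero_eq_eval_zero, coeff_zero_reverse]
  rw [h2] at h1
  refine h1.congr' ?_
  filter_upwards [Bornology.eventually_ne_cobounded (0 : ℂ)] with z hz
  let _ : Invertible z := invertibleOfNonzero hz
  have := eval₂_reverse_mul_pow (RingHom.id ℂ) z p
  rw [invOf_eq_inv] at this
  rw [eq_div_iff (pow_ne_zero _ hz)]
  simpa [eval₂_id] using this

/-- The ratio of suitable powers of two polynomials has a positive limit at infinity. -/
lemma ratio_tendsto (p q : ℂ[X]) (hq : q ≠ 0) :
    Filter.Tendsto (fun z : ℂ => ‖p.eval z‖ ^ q.natDegree / ‖q.eval z‖ ^ p.natDegree)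
      (Bornology.cobounded ℂ)
      (nhds (‖p.leadingCoeff‖ ^ q.natDegree / ‖q.leadingCoeff‖ ^ p.natDegree)) := by
  have h1 := (poly_div_pow_tendsto p).norm.pow q.natDegree
  have h2 := (poly_div_pow_tendsto q).norm.pow p.natDegree
  have h3 := h1.div h2 (by simp [hq])
  refine h3.congr' ?_
  filter_upwards [Bornology.eventually_ne_cobounded (0 : ℂ)] with z hz
  have hz' : ‖z‖ ≠ 0 := by simpa using hz
  simp only [Pi.div_apply, norm_div, norm_pow, div_pow, ← pow_mul]
  rw [mul_comm q.natDegree p.natDegree, div_div_div_cancel_right₀ (pow_ne_zero _ hz')]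

lemma no_common_branch (p q : ℂ[X]) (hp : 0 < p.natDegree) (hq : 0 < q.natDegree)
    (α : ℂ) (β : ℝ) (hβ : 0 < β) (hβ1 : β ≠ 1) (t : ℝ → ℂ)
    (h1 : ∀ s : ℝ, p.eval (t s) = p.eval (s : ℂ) + α)
    (h2 : ∀ s : ℝ, q.eval (t s) = β * q.eval (s : ℂ)) : False := by
  have hq0 : q ≠ 0 := by rintro rfl; simp at hq
  have hp0 : p ≠ 0 := by rintro rfl; simp at hp
  have hs : Filter.Tendsto (fun s : ℝ => (s : ℂ)) Filter.atTop (Bornology.cobounded ℂ) := by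
    rw [← tendsto_norm_atTop_iff_cobounded]
    simpa using Filter.tendsto_abs_atTop_atTop
  have hps : Filter.Tendsto (fun s : ℝ => ‖p.eval (t s)‖) Filter.atTop Filter.atTop := by
    have := (p + C α).tendsto_norm_atTop (by
      rw [degree_add_C (natDegree_pos_iff_degree_pos.mp hp)]
      exact natDegree_pos_iff_degree_pos.mp hp) (tendsto_norm_atTop_iff_cobounded.mpr hs)
    simpa [h1] using this
  have ht : Filter.Tendsto t Filter.atTop (Bornology.cobounded ℂ) := by
    have h := Filter.comap_cocompact_le p.continuous
    rw [← Metric.cobounded_eq_cocompact] at h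
    exact Filter.Tendsto.mono_right
      (Filter.tendsto_comap_iff.mpr (tendsto_norm_atTop_iff_cobounded.mp hps)) h
  have e1 := (ratio_tendsto p q hq0).comp ht
  have e2 := (ratio_tendsto (p + C α) q hq0).comp hs
  have hd : (p + C α).natDegree = p.natDegree := natDegree_add_C
  have hl : (p + C α).leadingCoeff = p.leadingCoeff :=
    leadingCoeff_add_of_degree_lt' (lt_of_le_of_lt degree_C_le (natDegree_pos_iff_degree_pos.mp hp))
  rw [hd, hl] at e2
  have e3 := e2.div_const (β ^ p.natDegree)
  have e4 := tendsto_nhds_unique e1 (e3.congr fun s => by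
    simp only [Function.comp, h1, h2, eval_add, eval_C, norm_mul, Complex.norm_real,
      Real.norm_eq_abs, abs_of_pos hβ, mul_pow]
    rw [div_div, mul_comm (β ^ _)])
  have hL : (0 : ℝ) < ‖p.leadingCoeff‖ ^ q.natDegree / ‖q.leadingCoeff‖ ^ p.natDegree := by
    have a1 : 0 < ‖p.leadingCoeff‖ := by simpa using hp0
    have a2 : 0 < ‖q.leadingCoeff‖ := by simpa using hq0
    positivity
  have hb : β ^ p.natDegree = 1 := by
    have : 0 < β ^ p.natDegree := by positivity
    rw [eq_div_iff this.ne'] at e4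
    exact (mul_eq_left₀ hL.ne').mp e4
  exact hβ1 ((pow_eq_one_iff_of_nonneg hβ.le hp.ne').mp hb)

/-- A crude Bezout bound. -/
lemma bezout (u v : ℝ[X]) (δ : ℕ) (hu : 0 < u.natDegree) (hv : 0 < v.natDegree)
    (hu' : u.natDegree ≤ δ) (hv' : v.natDegree ≤ δ) (α β : ℝ) (hβ : 0 < β) (hβ1 : β ≠ 1) :
    ∃ T : Finset ℝ, T.card ≤ 2 * δ ^ 2 ∧
      ∀ t s : ℝ, u.eval t = u.eval s + α → v.eval t = β * v.eval s → s ∈ T := by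
  set U : ℝ[X][X] := u.map C - C (u + C α) with hU
  set V : ℝ[X][X] := v.map C - C (C β * v) with hV
  have dU : U.natDegree = u.natDegree := by
    rw [hU, natDegree_sub_C, natDegree_map_eq_of_injective C_injective]
  have dV : V.natDegree = v.natDegree := by
    rw [hV, natDegree_sub_C, natDegree_map_eq_of_injective C_injective]
  set R : ℝ[X] := resultant U V u.natDegree v.natDegree with hR
  have hmap : ∀ {K : Type} [CommRing K] (φ : ℝ →+* K) (z : K),
      resultant (u.map φ - C ((u.map φ).eval z + φ α)) (v.map φ - C (φ β * (v.map φ).eval z))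
        u.natDegree v.natDegree = R.eval₂ φ z := by
    intro K _ φ z
    have := resultant_map_map U V u.natDegree v.natDegree (eval₂RingHom φ z)
    rw [coe_eval₂RingHom] at this
    rw [← this]
    have hc : (eval₂RingHom φ z).comp C = φ := by ext; simp
    congr 1
    · simp [hU, Polynomial.map_map, hc, eval_map]
    · simp [hV, Polynomial.map_map, hc, eval_map]
  have hR0 : R ≠ 0 := by
    intro h0
    have key : ∀ s : ℝ, ∃ t : ℂ,
        (u.map Complex.ofRealHom).eval t = (u.map Complex.ofRealHom).eval (s : ℂ) + α ∧
        (v.map Complex.ofRealHom).eval t = β * (v.map Complex.ofRealHom).eval (s : ℂ) := by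
      intro s
      have h := hmap Complex.ofRealHom (s : ℂ)
      rw [h0, eval₂_zero] at h
      set f := (u.map Complex.ofRealHom - C ((u.map Complex.ofRealHom).eval (s : ℂ) + Complex.ofRealHom α)) with hf
      set g := (v.map Complex.ofRealHom - C (Complex.ofRealHom β * (v.map Complex.ofRealHom).eval (s : ℂ))) with hg
      have df : f.natDegree = u.natDegree := by
        rw [hf, natDegree_sub_C, natDegree_map_eq_of_injective Complex.ofRealHom.injective]
      have dg : g.natDegree = v.natDegree := by
        rw [hg, natDegree_sub_C, natDegree_map_eq_of_injective Complex.ofRealHom.injective]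
      rw [← df, ← dg, resultant_eq_zero_iff,
        isCoprime_iff_aeval_ne_zero_of_isAlgClosed ℂ ℂ] at h
      have h' := h.2
      push Not at h'
      obtain ⟨t, ht1, ht2⟩ := h'
      refine ⟨t, ?_, ?_⟩
      · simpa [hf, sub_eq_zero] using ht1
      · simpa [hg, sub_eq_zero] using ht2
    choose t ht using key
    refine no_common_branch (u.map Complex.ofRealHom) (v.map Complex.ofRealHom) ?_ ?_ α β hβ hβ1 t
      (fun s => (ht s).1) (fun s => (ht s).2)
    · rwa [natDegree_map_eq_of_injective Complex.ofRealHom.injective]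
    · rwa [natDegree_map_eq_of_injective Complex.ofRealHom.injective]
  have hdeg : R.natDegree ≤ 2 * δ ^ 2 := by
    have hcU : ∀ i, (U.coeff i).natDegree ≤ δ := by
      intro i
      rw [hU, coeff_sub, coeff_map, coeff_C]
      refine (natDegree_sub_le _ _).trans ?_
      split_ifs <;> simp [hu']
    have hcV : ∀ i, (V.coeff i).natDegree ≤ δ := by
      intro i
      rw [hV, coeff_sub, coeff_map, coeff_C]
      refine (natDegree_sub_le _ _).trans ?_
      split_ifs
      · simpa using (natDegree_C_mul_le _ _).trans hv'
      · simp
    have hent : ∀ i j, (sylvester U V u.natDegree v.natDegree i j).natDegree ≤ δ := by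
      intro i j
      simp only [sylvester, Matrix.of_apply]
      refine Fin.addCases (fun j => ?_) (fun j => ?_) j
      · rw [Fin.addCases_left]; split_ifs
        · exact hcV _
        · simp
      · rw [Fin.addCases_right]; split_ifs
        · exact hcU _
        · simp
    rw [hR, resultant, Matrix.det_apply]
    refine natDegree_sum_le_of_forall_le _ _ fun σ _ => ?_
    refine (natDegree_smul_le _ _).trans ((natDegree_prod_le _ _).trans ?_)
    refine (Finset.sum_le_sum fun i _ => hent _ _).trans ?_
    simp
    nlinarith
  refine ⟨R.roots.toFinset, ?_, ?_⟩
  · exact (Multiset.toFinset_card_le _).trans ((card_roots' R).trans hdeg)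
  · intro t s h1 h2
    rw [Multiset.mem_toFinset, mem_roots hR0, IsRoot.def]
    have h := hmap (RingHom.id ℝ) s
    have hid : ∀ p p' : ℝ[X], p' = p.map (RingHom.id ℝ) → p' = p := fun p p' h => by
      rw [h, Polynomial.map_id]
    generalize hu1 : Polynomial.map (RingHom.id ℝ) u = u1 at h
    generalize hv1 : Polynomial.map (RingHom.id ℝ) v = v1 at h
    rw [hid u u1 hu1.symm, hid v v1 hv1.symm] at h
    simp only [RingHom.id_apply, eval₂_id] at h
    rw [← h]
    obtain ⟨a, b, -, -, hab⟩ := exists_mul_add_mul_eq_C_resultant (m := u.natDegree)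
      (n := v.natDegree) (u - C (u.eval s + α)) (v - C (β * v.eval s))
      (natDegree_sub_C.le) (natDegree_sub_C.le) (Or.inl hu.ne')
    have := congrArg (eval t) hab
    simpa [h1, h2] using this.symm

/-- Number of elements of `S` below `x`. -/
def rk (S : Finset ℝ) (x : ℝ) : ℕ := (S.filter (· < x)).card

lemma rk_mono (S : Finset ℝ) : Monotone (rk S) := by
  intro x y h
  refine Finset.card_le_card fun s hs => ?_
  rw [Finset.mem_filter] at hs ⊢
  exact ⟨hs.1, hs.2.trans_le h⟩

lemma rk_lt (S : Finset ℝ) {x : ℝ} (hx : x ∈ S) : rk S x < S.card := by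
  refine Finset.card_lt_card ?_
  rw [Finset.filter_ssubset]
  exact ⟨x, hx, lt_irrefl x⟩

lemma rk_strict (S : Finset ℝ) {x y : ℝ} (hx : x ∈ S) (h : x < y) : rk S x < rk S y := by
  refine Finset.card_lt_card ⟨fun s hs => ?_, fun hh => ?_⟩
  · rw [Finset.mem_filter] at hs ⊢
    exact ⟨hs.1, hs.2.trans h⟩
  · have := hh (Finset.mem_filter.mpr ⟨hx, h⟩)
    exact lt_irrefl _ (Finset.mem_filter.mp this).2

lemma rk_inj (S : Finset ℝ) {x y : ℝ} (hx : x ∈ S) (hy : y ∈ S) (h : rk S x = rk S y) :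
    x = y := by
  rcases lt_trichotomy x y with hxy | hxy | hxy
  · exact absurd h (rk_strict S hx hxy).ne
  · exact hxy
  · exact absurd h (rk_strict S hy hxy).ne'

/-- Pairs of elements of `S` which are close in rank. -/
def near (S : Finset ℝ) (n : ℕ) : Finset (ℝ × ℝ) :=
  (S ×ˢ S).filter fun p => (n : ℤ) * |(rk S p.2 : ℤ) - rk S p.1| < 4 * S.card

lemma near_card (S : Finset ℝ) (n : ℕ) (hn : n ≤ S.card) :
    n * (near S n).card ≤ 9 * S.card ^ 2 := by
  rcases Nat.eq_zero_or_pos n with rfl | hn0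
  · simp
  set k := 4 * S.card / n with hk
  have h1 : (near S n).card ≤ (2 * k + 1) * S.card := by
    refine Finset.card_le_mul_card_image_of_maps_to (f := Prod.fst) (t := S) ?_ _ ?_
    · intro p hp
      simp only [near, Finset.mem_filter, Finset.mem_product] at hp
      exact hp.1.1
    · intro x hx
      have : (Finset.Icc ((rk S x : ℤ) - k) (rk S x + k)).card = 2 * k + 1 := by
        rw [Int.card_Icc]; omega
      rw [← this]
      refine Finset.card_le_card_of_injOn (fun p => (rk S p.2 : ℤ)) ?_ ?_
      · intro p hp
        simp only [near, Finset.coe_filter, Finset.mem_filter, Finset.mem_product,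
          Set.mem_ofPred_eq] at hp
        obtain ⟨⟨_, h2⟩, rfl⟩ := hp
        have h3 : |(rk S p.2 : ℤ) - rk S p.1| ≤ k := by
          rw [hk]; push_cast
          rw [Int.le_ediv_iff_mul_le (by exact_mod_cast hn0)]
          linarith [mul_comm (n : ℤ) |(rk S p.2 : ℤ) - rk S p.1|]
        rw [abs_le] at h3
        simp only [Finset.coe_Icc, Set.mem_Icc]
        constructor <;> linarith
      · intro p hp p' hp' h
        simp only [near, Finset.coe_filter, Finset.mem_filter, Finset.mem_product,
          Set.mem_ofPred_eq] at hp hp'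
        have h' : (rk S p.2 : ℤ) = rk S p'.2 := h
        have := rk_inj S hp.1.1.2 hp'.1.1.2 (by exact_mod_cast h')
        exact Prod.ext (hp.2.trans hp'.2.symm) this
  have h2 : n * k ≤ 4 * S.card := Nat.mul_div_le _ _
  calc n * (near S n).card ≤ n * ((2 * k + 1) * S.card) := Nat.mul_le_mul_left _ h1
    _ = (2 * (n * k) + n) * S.card := by ring
    _ ≤ (9 * S.card) * S.card := Nat.mul_le_mul_right _ (by omega)
    _ = _ := by ring

/-- A monotone integer sequence has few large gaps. -/
lemma gaps_mono (f : ℕ → ℤ) (n M : ℕ) (hM : ∀ i < n, 0 ≤ f i ∧ f i < M)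
    (hf : ∀ i, i + 1 < n → f i ≤ f (i + 1)) :
    4 * ((Finset.range (n - 1)).filter
      fun i => ¬ ((n : ℤ) * |f (i + 1) - f i| < 4 * M)).card ≤ n := by
  rcases Nat.eq_zero_or_pos n with rfl | hn0
  · simp
  set G := (Finset.range (n - 1)).filter fun i => ¬ ((n : ℤ) * |f (i + 1) - f i| < 4 * M)
  have hM0 : (0 : ℤ) < M := (hM 0 hn0).1.trans_lt (hM 0 hn0).2
  have h1 : (G.card : ℤ) * (4 * M) ≤ ∑ i ∈ Finset.range (n - 1), (n : ℤ) * (f (i + 1) - f i) := by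
    calc (G.card : ℤ) * (4 * M) = ∑ i ∈ G, (4 * M : ℤ) := by simp
      _ ≤ ∑ i ∈ G, (n : ℤ) * (f (i + 1) - f i) := by
        refine Finset.sum_le_sum fun i hi => ?_
        rw [Finset.mem_filter, Finset.mem_range, not_lt] at hi
        rw [abs_of_nonneg (sub_nonneg.mpr (hf i (by omega)))] at hi
        exact hi.2
      _ ≤ _ := by
        refine Finset.sum_le_sum_of_subset_of_nonneg (Finset.filter_subset _ _) ?_
        intro i hi _
        rw [Finset.mem_range] at hi
        have := hf i (by omega)
        exact mul_nonneg (by positivity) (by linarith)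
  rw [← Finset.mul_sum, Finset.sum_range_sub] at h1
  have h2 := hM (n - 1) (by omega)
  have h3 := hM 0 hn0
  have h4 : (G.card : ℤ) * (4 * M) ≤ n * M :=
    h1.trans (mul_le_mul_of_nonneg_left (by linarith) (by positivity))
  have h5 : (4 * G.card : ℤ) ≤ n := le_of_mul_le_mul_right (by linarith) hM0
  exact_mod_cast h5

lemma gaps (f : ℕ → ℤ) (n M : ℕ) (hM : ∀ i < n, 0 ≤ f i ∧ f i < M)
    (hf : (∀ i, i + 1 < n → f i ≤ f (i + 1)) ∨ (∀ i, i + 1 < n → f (i + 1) ≤ f i)) :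
    4 * ((Finset.range (n - 1)).filter
      fun i => ¬ ((n : ℤ) * |f (i + 1) - f i| < 4 * M)).card ≤ n := by
  rcases hf with hf | hf
  · exact gaps_mono f n M hM hf
  · have := gaps_mono (fun i => M - 1 - f i) n M
      (fun i hi => by have := hM i hi; constructor <;> linarith)
      (fun i hi => by have := hf i hi; linarith)
    have e : ∀ i, |(M : ℤ) - 1 - f (i + 1) - (M - 1 - f i)| = |f (i + 1) - f i| := by
      intro i
      rw [← abs_neg]; congr 1; ring
    simpa only [e] using this

lemma exists_enum (A : Finset ℝ) : ∃ a : ℕ → ℝ, (∀ i < A.card, a i ∈ A) ∧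
    ∀ i j, i < j → j < A.card → a i < a j := by
  refine ⟨fun i => if h : i < A.card then A.orderEmbOfFin rfl ⟨i, h⟩ else 0, ?_, ?_⟩
  · intro i hi
    simp only [hi, dif_pos]
    exact A.orderEmbOfFin_mem rfl _
  · intro i j hij hj
    simp only [hj, hij.trans hj, dif_pos]
    exact (A.orderEmbOfFin rfl).strictMono (by simpa using hij)

/-- `u` and `v` are strictly monotone on `A`, and `v` has constant nonzero sign there. -/
def Good (u v : ℝ[X]) (A : Finset ℝ) : Prop :=
  (StrictMonoOn (fun x => u.eval x) A ∨ StrictAntiOn (fun x => u.eval x) A) ∧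
  (StrictMonoOn (fun x => v.eval x) A ∨ StrictAntiOn (fun x => v.eval x) A) ∧
  ∀ a ∈ A, ∀ b ∈ A, 0 < v.eval a * v.eval b

lemma strict_inj {f : ℝ → ℝ} {A : Set ℝ} (h : StrictMonoOn f A ∨ StrictAntiOn f A) :
    Set.InjOn f A := h.elim (fun h => h.injOn) (fun h => h.injOn)

/-- The few-gaps statement along the images of an increasing sequence. -/
lemma gaps_rk (S A : Finset ℝ) (a : ℕ → ℝ) (ha : ∀ i < A.card, a i ∈ A)
    (ha' : ∀ i j, i < j → j < A.card → a i < a j) (g : ℝ → ℝ)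
    (hg : MonotoneOn g A ∨ AntitoneOn g A) (hgS : ∀ x ∈ A, g x ∈ S) :
    4 * ((Finset.range (A.card - 1)).filter
      fun i => ¬ ((A.card : ℤ) * |(rk S (g (a (i + 1))) : ℤ) - rk S (g (a i))|
        < 4 * S.card)).card ≤ A.card := by
  refine gaps (fun i => (rk S (g (a i)) : ℤ)) A.card S.card ?_ ?_
  · intro i hi
    exact ⟨by positivity, by exact_mod_cast rk_lt S (hgS _ (ha i hi))⟩
  · refine hg.imp (fun h i hi => ?_) (fun h i hi => ?_)
    · exact_mod_cast rk_mono S (h (ha i (by omega)) (ha _ hi) (ha' _ _ (by omega) hi).le)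
    · exact_mod_cast rk_mono S (h (ha i (by omega)) (ha _ hi) (ha' _ _ (by omega) hi).le)

lemma key (u v : ℝ[X]) (δ : ℕ) (hu : 0 < u.natDegree) (hv : 0 < v.natDegree)
    (hu' : u.natDegree ≤ δ) (hv' : v.natDegree ≤ δ) (A S' P' S P : Finset ℝ)
    (hA : Good u v A) (h0 : ∀ m ∈ P', m ≠ 0)
    (hS : ∀ a ∈ A, ∀ c ∈ S', u.eval a + c ∈ S) (hP : ∀ a ∈ A, ∀ m ∈ P', v.eval a * m ∈ P) :
    A.card ^ 3 * (S'.card * P'.card) ≤ 648 * δ ^ 2 * (S.card * P.card) ^ 2 := by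
  obtain ⟨hAu, hAv, hAs⟩ := hA
  set n := A.card with hn
  have hδ : 1 ≤ δ ^ 2 := Nat.one_le_pow _ _ (by omega)
  rcases S'.eq_empty_or_nonempty with rfl | ⟨c0, hc0⟩
  · simp
  rcases P'.eq_empty_or_nonempty with rfl | ⟨m0, hm0⟩
  · simp
  rcases A.eq_empty_or_nonempty with hA0 | ⟨a0, ha0⟩
  · simp [hn, hA0]
  have hv0 : ∀ a ∈ A, v.eval a ≠ 0 := fun a ha h => by
    have := hAs a ha a ha
    simp [h] at this
  -- sizes
  have hnS : n ≤ S.card := Finset.card_le_card_of_injOn (fun x => u.eval x + c0)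
    (fun x hx => hS x hx c0 hc0) (fun x hx y hy h => strict_inj hAu hx hy (by simpa using h))
  have hnP : n ≤ P.card := Finset.card_le_card_of_injOn (fun x => v.eval x * m0)
    (fun x hx => hP x hx m0 hm0)
    (fun x hx y hy h => strict_inj hAv hx hy (by simpa [h0 m0 hm0] using h))
  have hSS : S'.card ≤ S.card := Finset.card_le_card_of_injOn (fun c => u.eval a0 + c)
    (fun c hc => hS a0 ha0 c hc) (fun x hx y hy h => by simpa using h)
  have hPP : P'.card ≤ P.card := Finset.card_le_card_of_injOn (fun m => v.eval a0 * m)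
    (fun c hc => hP a0 ha0 c hc) (fun x hx y hy h => by simpa [hv0 a0 ha0] using h)
  have hL := Nat.mul_le_mul hSS hPP
  rcases Nat.lt_or_ge n 4 with hn4 | hn4
  · have h27 : n ^ 3 ≤ 27 := by
      calc n ^ 3 ≤ 3 ^ 3 := Nat.pow_le_pow_left (by omega) 3
        _ = 27 := by norm_num
    calc n ^ 3 * (S'.card * P'.card) ≤ 27 * (S.card * P.card) := Nat.mul_le_mul h27 hL
      _ ≤ 648 * δ ^ 2 * (S.card * P.card) ^ 2 := by
        refine Nat.mul_le_mul (by omega) (Nat.le_self_pow (by norm_num) _)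
  obtain ⟨a, ha, ha'⟩ := exists_enum A
  rw [← hn] at ha ha'
  set Q := ((S' ×ˢ P') ×ˢ Finset.range (n - 1)).filter fun q =>
    ((n : ℤ) * |(rk S (u.eval (a (q.2 + 1)) + q.1.1) : ℤ) - rk S (u.eval (a q.2) + q.1.1)|
      < 4 * S.card) ∧
    ((n : ℤ) * |(rk P (v.eval (a (q.2 + 1)) * q.1.2) : ℤ) - rk P (v.eval (a q.2) * q.1.2)|
      < 4 * P.card) with hQ
  have lower : (S'.card * P'.card) * (n - 2) ≤ 2 * Q.card := by
    have hfib : ∀ p ∈ S' ×ˢ P', n - 2 ≤ 2 * (Q.filter fun q => q.1 = p).card := by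
      rintro ⟨c, m⟩ hp
      rw [Finset.mem_product] at hp
      have g1 := gaps_rk S A a ha ha' (fun x => u.eval x + c)
        (hAu.imp (fun h => (h.monotoneOn).add_const c) (fun h => (h.antitoneOn).add_const c))
        (fun x hx => hS x hx c hp.1)
      have hmv : StrictMonoOn (fun x => v.eval x * m) A ∨ StrictAntiOn (fun x => v.eval x * m) A := by
        rcases lt_or_gt_of_ne (h0 m hp.2) with hm | hm
        · exact hAv.symm.imp (fun h x hx y hy hxy => mul_lt_mul_of_neg_right (h hx hy hxy) hm)
            (fun h x hx y hy hxy => mul_lt_mul_of_neg_right (h hx hy hxy) hm)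
        · exact hAv.imp (fun h x hx y hy hxy => mul_lt_mul_of_pos_right (h hx hy hxy) hm)
            (fun h x hx y hy hxy => mul_lt_mul_of_pos_right (h hx hy hxy) hm)
      have g2 := gaps_rk P A a ha ha' (fun x => v.eval x * m)
        (hmv.imp (fun h => h.monotoneOn) (fun h => h.antitoneOn))
        (fun x hx => hP x hx m hp.2)
      rw [← hn] at g1 g2
      set B1 := (Finset.range (n - 1)).filter fun i =>
        ¬ ((n : ℤ) * |(rk S (u.eval (a (i + 1)) + c) : ℤ) - rk S (u.eval (a i) + c)| < 4 * S.card)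
      set B2 := (Finset.range (n - 1)).filter fun i =>
        ¬ ((n : ℤ) * |(rk P (v.eval (a (i + 1)) * m) : ℤ) - rk P (v.eval (a i) * m)| < 4 * P.card)
      have hsub : Finset.range (n - 1) ⊆
          ((Q.filter fun q => q.1 = (c, m)).image Prod.snd) ∪ (B1 ∪ B2) := by
        intro i hi
        by_cases b1 : i ∈ B1
        · simp [b1]
        by_cases b2 : i ∈ B2
        · simp [b2]
        refine Finset.mem_union_left _ (Finset.mem_image.mpr ⟨((c, m), i), ?_, rfl⟩)
        simp only [B1, B2, Finset.mem_filter, hi, true_and, not_not] at b1 b2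
        simp only [hQ, Finset.mem_filter, Finset.mem_product, hi, hp.1, hp.2, true_and, and_true]
        exact ⟨b1, b2⟩
      have c1 := Finset.card_le_card hsub
      have c2 := Finset.card_union_le ((Q.filter fun q => q.1 = (c, m)).image Prod.snd) (B1 ∪ B2)
      have c3 := Finset.card_union_le B1 B2
      have c4 : ((Q.filter fun q => q.1 = (c, m)).image Prod.snd).card ≤ _ := Finset.card_image_le
      rw [Finset.card_range] at c1
      omega
    have hmt : ∀ q ∈ Q, q.1 ∈ S' ×ˢ P' := by
      intro q hq
      simp only [hQ, Finset.mem_filter, Finset.mem_product] at hq ⊢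
      exact hq.1.1
    rw [Finset.card_eq_sum_card_fiberwise hmt, Finset.mul_sum, ← Finset.card_product,
      ← smul_eq_mul]
    exact Finset.card_nsmul_le_sum _ _ _ hfib
  have upper : Q.card ≤ (2 * δ ^ 2) * (near S n ×ˢ near P n).card := by
    refine Finset.card_le_mul_card_image_of_maps_to
      (f := fun q => ((u.eval (a q.2) + q.1.1, u.eval (a (q.2 + 1)) + q.1.1),
        (v.eval (a q.2) * q.1.2, v.eval (a (q.2 + 1)) * q.1.2))) ?_ _ ?_
    · intro q hq
      simp only [hQ, Finset.mem_filter, Finset.mem_product, Finset.mem_range] at hq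
      obtain ⟨⟨⟨hc, hm⟩, hi⟩, hq1, hq2⟩ := hq
      simp only [near, Finset.mem_filter, Finset.mem_product]
      have e1 := ha q.2 (by omega)
      have e2 := ha (q.2 + 1) (by omega)
      exact ⟨⟨⟨hS _ e1 _ hc, hS _ e2 _ hc⟩, hq1⟩, ⟨⟨hP _ e1 _ hm, hP _ e2 _ hm⟩, hq2⟩⟩
    · rintro ⟨⟨x1, x2⟩, ⟨y1, y2⟩⟩ -
      set F := Q.filter fun q => ((u.eval (a q.2) + q.1.1, u.eval (a (q.2 + 1)) + q.1.1),
        (v.eval (a q.2) * q.1.2, v.eval (a (q.2 + 1)) * q.1.2)) = ((x1, x2), (y1, y2)) with hF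
      have hFm : ∀ q ∈ F, (q.1.2 ≠ 0 ∧ q.2 + 1 < n) ∧
          (u.eval (a q.2) + q.1.1 = x1 ∧ u.eval (a (q.2 + 1)) + q.1.1 = x2) ∧
          v.eval (a q.2) * q.1.2 = y1 ∧ v.eval (a (q.2 + 1)) * q.1.2 = y2 := by
        intro q hq
        simp only [hF, hQ, Finset.mem_filter, Finset.mem_product, Finset.mem_range,
          Prod.mk.injEq] at hq
        exact ⟨⟨h0 _ hq.1.1.1.2, by omega⟩, hq.2⟩
      rcases F.eq_empty_or_nonempty with hFe | ⟨q0, hq0⟩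
      · simp [hFe]
      obtain ⟨⟨hm, hi⟩, ⟨hx1, hx2⟩, hy1, hy2⟩ := hFm q0 hq0
      have e1 := ha q0.2 (by omega)
      have e2 := ha (q0.2 + 1) (by omega)
      have hy1' : y1 ≠ 0 := by rw [← hy1]; exact mul_ne_zero (hv0 _ e1) hm
      have hβ : 0 < y2 / y1 := by
        rw [← hy1, ← hy2, mul_div_mul_right _ _ hm]
        have := hAs _ e2 _ e1
        exact (div_pos_iff.mpr (mul_pos_iff.mp this))
      have hβ1 : y2 / y1 ≠ 1 := by
        rw [Ne, div_eq_one_iff_eq hy1', ← hy1, ← hy2]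
        intro h
        have := strict_inj hAv e2 e1 (mul_right_cancel₀ hm h)
        exact (ha' q0.2 (q0.2 + 1) (by omega) hi).ne' this
      obtain ⟨T, hT, hT'⟩ := bezout u v δ hu hv hu' hv' (x2 - x1) (y2 / y1) hβ hβ1
      refine le_trans (Finset.card_le_card_of_injOn (fun q => a q.2) ?_ ?_) hT
      · intro q hq
        obtain ⟨⟨hm, hi⟩, ⟨hx1, hx2⟩, hy1, hy2⟩ := hFm q hq
        refine hT' (a (q.2 + 1)) (a q.2) (by rw [← hx1, ← hx2]; ring) ?_
        rw [← hy1, ← hy2]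
        have := hv0 _ (ha q.2 (by omega))
        field_simp
      · intro q hq q' hq' h
        obtain ⟨⟨hm, hi⟩, ⟨hx1, hx2⟩, hy1, hy2⟩ := hFm q hq
        obtain ⟨⟨hm', hi'⟩, ⟨hx1', hx2'⟩, hy1', hy2'⟩ := hFm q' hq'
        have hii : q.2 = q'.2 := by
          rcases lt_trichotomy q.2 q'.2 with hl | hl | hl
          · exact absurd h (ha' _ _ hl (by omega)).ne
          · exact hl
          · exact absurd h (ha' _ _ hl (by omega)).ne'
        rw [← hii] at hx1' hy1'
        refine Prod.ext (Prod.ext ?_ ?_) hii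
        · linarith
        · exact mul_left_cancel₀ (hv0 _ (ha q.2 (by omega))) (hy1.trans hy1'.symm)
  have w1 := near_card S n hnS
  have w2 := near_card P n hnP
  have w := Nat.mul_le_mul w1 w2
  rw [Finset.card_product] at upper
  have hn2 : n ≤ 2 * (n - 2) := by omega
  calc n ^ 3 * (S'.card * P'.card) = n ^ 2 * ((S'.card * P'.card) * n) := by ring
    _ ≤ n ^ 2 * ((S'.card * P'.card) * (2 * (n - 2))) := by gcongr
    _ = n ^ 2 * (2 * ((S'.card * P'.card) * (n - 2))) := by ring
    _ ≤ n ^ 2 * (2 * (2 * (2 * δ ^ 2 * ((near S n).card * (near P n).card)))) := by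
      exact Nat.mul_le_mul_left _ (Nat.mul_le_mul_left _
        (lower.trans (Nat.mul_le_mul_left _ upper)))
    _ = 8 * δ ^ 2 * (n * (near S n).card * (n * (near P n).card)) := by ring
    _ ≤ 8 * δ ^ 2 * (9 * S.card ^ 2 * (9 * P.card ^ 2)) := by gcongr
    _ = _ := by ring

lemma strict_of_deriv_ne (u : ℝ[X]) (a b : ℝ) (hab : a ≤ b)
    (h : ∀ x ∈ Set.Icc a b, (derivative u).eval x ≠ 0) :
    StrictMonoOn (fun x => u.eval x) (Set.Icc a b) ∨
      StrictAntiOn (fun x => u.eval x) (Set.Icc a b) := by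
  have aux : ∀ x ∈ Set.Icc a b, ∀ y ∈ Set.Icc a b, x < y → u.eval x ≠ u.eval y := by
    intro x hx y hy hxy he
    obtain ⟨c, hc, hc'⟩ := exists_deriv_eq_zero (f := fun x => u.eval x) hxy
      u.continuous.continuousOn he
    rw [Polynomial.deriv] at hc'
    exact h c ⟨hx.1.trans hc.1.le, hc.2.le.trans hy.2⟩ hc'
  refine ContinuousOn.strictMonoOn_of_injOn_Icc' hab u.continuous.continuousOn ?_
  intro x hx y hy he
  rcases lt_trichotomy x y with hl | hl | hl
  · exact absurd he (aux x hx y hy hl)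
  · exact hl
  · exact absurd he.symm (aux y hy x hx hl)

lemma exists_good (u v : ℝ[X]) (δ : ℕ) (hu : 0 < u.natDegree) (hv : 0 < v.natDegree)
    (hu' : u.natDegree ≤ δ) (hv' : v.natDegree ≤ δ) (A : Finset ℝ) :
    ∃ B ⊆ A, Good u v B ∧ A.card ≤ 3 * δ + (3 * δ + 1) * B.card := by
  set W := derivative u * derivative v * v with hW
  have hdu : derivative u ≠ 0 := fun h => hu.ne' (derivative_eq_zero.mp h)
  have hdv : derivative v ≠ 0 := fun h => hv.ne' (derivative_eq_zero.mp h)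
  have hv0 : v ≠ 0 := by rintro rfl; simp at hv
  have hW0 : W ≠ 0 := mul_ne_zero (mul_ne_zero hdu hdv) hv0
  set Z := W.roots.toFinset with hZ
  have hZc : Z.card ≤ 3 * δ := by
    refine (Multiset.toFinset_card_le _).trans ((card_roots' W).trans ?_)
    have h1 : W.natDegree ≤ _ := natDegree_mul_le
    have h2 : (derivative u * derivative v).natDegree ≤ _ := natDegree_mul_le
    have h3 := natDegree_derivative_le u
    have h4 := natDegree_derivative_le v
    omega
  have hZm : ∀ x, x ∉ Z →
      (derivative u).eval x ≠ 0 ∧ (derivative v).eval x ≠ 0 ∧ v.eval x ≠ 0 := by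
    intro x hx
    rw [hZ, Multiset.mem_toFinset, mem_roots hW0, IsRoot.def, hW, eval_mul, eval_mul] at hx
    refine ⟨fun h => hx ?_, fun h => hx ?_, fun h => hx ?_⟩ <;> simp [h]
  have hrk : ∀ x, rk Z x < 3 * δ + 1 := fun x =>
    Nat.lt_succ_of_le ((Finset.card_le_card (Finset.filter_subset _ _)).trans hZc)
  obtain ⟨k, hk, hkmax⟩ := Finset.exists_max_image (Finset.range (3 * δ + 1))
    (fun k => ((A \ Z).filter fun x => rk Z x = k).card) ⟨0, by simp⟩
  set B := (A \ Z).filter fun x => rk Z x = k with hB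
  have hcard : (A \ Z).card ≤ B.card * (Finset.range (3 * δ + 1)).card :=
    Finset.card_le_mul_card_image_of_maps_to (f := rk Z)
      (fun x _ => Finset.mem_range.mpr (hrk x)) _ hkmax
  rw [Finset.card_range] at hcard
  have hBA : B ⊆ A := (Finset.filter_subset _ _).trans Finset.sdiff_subset
  refine ⟨B, hBA, ?_, ?_⟩
  · rcases B.eq_empty_or_nonempty with hBe | hBn
    · rw [hBe]; simp [Good, StrictMonoOn]
    have hBm : ∀ x ∈ B, x ∉ Z ∧ rk Z x = k := by
      intro x hx
      rw [hB, Finset.mem_filter, Finset.mem_sdiff] at hx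
      exact ⟨hx.1.2, hx.2⟩
    set lo := B.min' hBn
    set hi := B.max' hBn
    have hlo := B.min'_mem hBn
    have hhi := B.max'_mem hBn
    have hlh : lo ≤ hi := B.min'_le _ hhi
    have hsub : (B : Set ℝ) ⊆ Set.Icc lo hi := fun x hx => ⟨B.min'_le _ hx, B.le_max' _ hx⟩
    have hno : ∀ x ∈ Set.Icc lo hi, x ∉ Z := by
      intro x hx hxZ
      rcases hx.2.lt_or_eq with h | h
      · have h1 := rk_strict Z hxZ h
        have h2 := rk_mono Z hx.1
        rw [(hBm _ hlo).2] at h2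
        rw [(hBm _ hhi).2] at h1
        omega
      · rw [h] at hxZ
        exact (hBm _ hhi).1 hxZ
    refine ⟨?_, ?_, ?_⟩
    · exact (strict_of_deriv_ne u lo hi hlh (fun x hx => (hZm x (hno x hx)).1)).imp
        (fun h => h.mono hsub) (fun h => h.mono hsub)
    · exact (strict_of_deriv_ne v lo hi hlh (fun x hx => (hZm x (hno x hx)).2.1)).imp
        (fun h => h.mono hsub) (fun h => h.mono hsub)
    · intro a ha b hb
      by_contra hcon
      have h0 : (0 : ℝ) ∈ Set.uIcc (v.eval a) (v.eval b) := by
        rw [Set.mem_uIcc]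
        rcases mul_nonpos_iff.mp (not_lt.mp hcon) with h | h
        · exact Or.inr ⟨h.2, h.1⟩
        · exact Or.inl h
      obtain ⟨x, hx, hx0⟩ := intermediate_value_uIcc (f := fun x => v.eval x)
        v.continuous.continuousOn h0
      exact (hZm x (hno x (Set.uIcc_subset_Icc (hsub ha) (hsub hb) hx))).2.2 hx0
  · have h1 := Finset.card_le_card_sdiff_add_card (s := A) (t := Z)
    nlinarith

lemma good_subset {u v : ℝ[X]} {A B : Finset ℝ} (h : Good u v A) (hBA : B ⊆ A) : Good u v B := by
  have hs : (B : Set ℝ) ⊆ A := by exact_mod_cast hBA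
  exact ⟨h.1.imp (fun h => h.mono hs) (fun h => h.mono hs),
    h.2.1.imp (fun h => h.mono hs) (fun h => h.mono hs),
    fun a ha b hb => h.2.2 a (hBA ha) b (hBA hb)⟩

/-- The set of sums. -/
def sumSet {d : ℕ} (u : Fin d → ℝ[X]) (A : Fin d → Finset ℝ) : Finset ℝ :=
  (Fintype.piFinset A).image fun a => ∑ i, (u i).eval (a i)

/-- The set of products. -/
def prodSet {d : ℕ} (v : Fin d → ℝ[X]) (A : Fin d → Finset ℝ) : Finset ℝ :=
  (Fintype.piFinset A).image fun a => ∏ i, (v i).eval (a i)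

lemma main_good (δ d : ℕ) : ∃ c : ℝ, 0 < c ∧
      ∀ u v : Fin (d + 1) → Polynomial ℝ,
        (∀ i, 0 < (u i).natDegree) → (∀ i, 0 < (v i).natDegree) →
        (∀ i, (u i).natDegree ≤ δ) → (∀ i, (v i).natDegree ≤ δ) →
        ∀ (n : ℕ) (A : Fin (d + 1) → Finset ℝ), (∀ i, (A i).card = n) →
          (∀ i, Good (u i) (v i) (A i)) →
          c * (n : ℝ) ^ ((3 : ℝ) - 1 / 2 ^ d) ≤
            ((sumSet u A).card : ℝ) * ((prodSet v A).card : ℝ) := by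
  induction d with
  | zero =>
    refine ⟨1, one_pos, ?_⟩
    intro u v _ _ _ _ n A hA hG
    have h1 : n ≤ (sumSet u A).card := by
      rw [← hA 0]
      refine Finset.card_le_card_of_injOn (fun x => (u 0).eval x) ?_ (strict_inj (hG 0).1)
      intro x hx
      refine Finset.mem_coe.mpr (Finset.mem_image.mpr ⟨fun _ => x, ?_, by simp⟩)
      rw [Fintype.mem_piFinset]
      intro i
      rw [show i = 0 from Fin.ext (by omega)]
      exact hx
    have h2 : n ≤ (prodSet v A).card := by
      rw [← hA 0]
      refine Finset.card_le_card_of_injOn (fun x => (v 0).eval x) ?_ (strict_inj (hG 0).2.1)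
      intro x hx
      refine Finset.mem_coe.mpr (Finset.mem_image.mpr ⟨fun _ => x, ?_, by simp⟩)
      rw [Fintype.mem_piFinset]
      intro i
      rw [show i = 0 from Fin.ext (by omega)]
      exact hx
    have h3 : ((3 : ℝ) - 1 / 2 ^ 0) = ((2 : ℕ) : ℝ) := by norm_num
    rw [h3, Real.rpow_natCast, one_mul, sq]
    exact_mod_cast Nat.mul_le_mul h1 h2
  | succ d ih =>
    obtain ⟨c, hc, ih⟩ := ih
    set D : ℝ := 648 * (δ : ℝ) ^ 2 + 1 with hD
    have hD0 : 0 < D := by positivity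
    refine ⟨Real.sqrt (c / D), Real.sqrt_pos.mpr (div_pos hc hD0), ?_⟩
    intro u v hu hv hu' hv' n A hA hG
    have hI := ih (fun i => u i.succ) (fun i => v i.succ) (fun i => hu _) (fun i => hv _)
      (fun i => hu' _) (fun i => hv' _) n (fun i => A i.succ) (fun i => hA _) (fun i => hG _)
    have hcons : ∀ a ∈ A 0, ∀ b ∈ Fintype.piFinset (fun i : Fin (d + 1) => A i.succ),
        (Fin.cons a b : Fin (d + 2) → ℝ) ∈ Fintype.piFinset A := by
      intro a ha b hb
      rw [Fintype.mem_piFinset] at hb ⊢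
      intro i
      refine Fin.cases ?_ (fun i => ?_) i
      · simpa using ha
      · simpa using hb i
    have hK := key (u 0) (v 0) δ (hu 0) (hv 0) (hu' 0) (hv' 0) (A 0)
      (sumSet (fun i => u i.succ) (fun i => A i.succ))
      (prodSet (fun i => v i.succ) (fun i => A i.succ)) (sumSet u A) (prodSet v A) (hG 0)
      (by
        intro m hm
        obtain ⟨b, hb, rfl⟩ := Finset.mem_image.mp hm
        rw [Fintype.mem_piFinset] at hb
        refine Finset.prod_ne_zero_iff.mpr fun i _ h => ?_
        have := (hG i.succ).2.2 _ (hb i) _ (hb i)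
        simp [h] at this)
      (by
        intro a ha m hm
        obtain ⟨b, hb, rfl⟩ := Finset.mem_image.mp hm
        refine Finset.mem_image.mpr ⟨_, hcons a ha b hb, ?_⟩
        rw [Fin.sum_univ_succ]
        simp)
      (by
        intro a ha m hm
        obtain ⟨b, hb, rfl⟩ := Finset.mem_image.mp hm
        refine Finset.mem_image.mpr ⟨_, hcons a ha b hb, ?_⟩
        rw [Fin.prod_univ_succ]
        simp)
    rw [hA 0] at hK
    set N' : ℝ := ((sumSet (fun i => u i.succ) (fun i => A i.succ)).card : ℝ) *
      ((prodSet (fun i => v i.succ) (fun i => A i.succ)).card : ℝ) with hN'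
    set N : ℝ := ((sumSet u A).card : ℝ) * ((prodSet v A).card : ℝ) with hN
    have hN0 : 0 ≤ N := by positivity
    have hK' : (n : ℝ) ^ 3 * N' ≤ D * N ^ 2 := by
      have : (n : ℝ) ^ 3 * N' ≤ 648 * (δ : ℝ) ^ 2 * N ^ 2 := by
        rw [hN, hN']; exact_mod_cast hK
      nlinarith [sq_nonneg N]
    have hexp : (0 : ℝ) < 3 - 1 / 2 ^ (d + 1) := by
      have : (1 : ℝ) / 2 ^ (d + 1) ≤ 1 := by
        rw [div_le_one (by positivity)]
        exact one_le_pow₀ (by norm_num)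
      linarith
    rcases Nat.eq_zero_or_pos n with hn | hn
    · rw [hn, Nat.cast_zero, Real.zero_rpow hexp.ne', mul_zero]
      exact hN0
    have hnr : (0 : ℝ) < n := by exact_mod_cast hn
    refine le_of_sq_le_sq ?_ hN0
    have e1 : ((n : ℝ) ^ ((3 : ℝ) - 1 / 2 ^ (d + 1))) ^ 2 =
        (n : ℝ) ^ 3 * (n : ℝ) ^ ((3 : ℝ) - 1 / 2 ^ d) := by
      rw [← Real.rpow_natCast, ← Real.rpow_mul hnr.le, ← Real.rpow_natCast (n : ℝ) 3,
        ← Real.rpow_add hnr]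
      congr 1
      rw [pow_succ]
      field_simp
      push_cast
      ring
    rw [mul_pow, Real.sq_sqrt (div_pos hc hD0).le, e1, div_mul_eq_mul_div, div_le_iff₀ hD0]
    calc c * ((n : ℝ) ^ 3 * (n : ℝ) ^ ((3 : ℝ) - 1 / 2 ^ d))
        = (n : ℝ) ^ 3 * (c * (n : ℝ) ^ ((3 : ℝ) - 1 / 2 ^ d)) := by ring
      _ ≤ (n : ℝ) ^ 3 * N' := mul_le_mul_of_nonneg_left hI (by positivity)
      _ ≤ D * N ^ 2 := hK'
      _ = _ := by ring

theorem stmt18 (d δ : ℕ) (hd : 2 ≤ d) :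
    ∃ c : ℝ, 0 < c ∧
      ∀ u v : Fin d → Polynomial ℝ,
        (∀ i, 0 < (u i).natDegree) → (∀ i, 0 < (v i).natDegree) →
        (∀ i, (u i).natDegree ≤ δ) → (∀ i, (v i).natDegree ≤ δ) →
        ∀ (n : ℕ) (A : Fin d → Finset ℝ), (∀ i, (A i).card = n) →
          c * (n : ℝ) ^ ((3 : ℝ) - 1 / 2 ^ (d - 1)) ≤
            (((Fintype.piFinset A).image fun a => ∑ i, (u i).eval (a i)).card : ℝ) *
            (((Fintype.piFinset A).image fun a => ∏ i, (v i).eval (a i)).card : ℝ) := by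
  obtain ⟨k, rfl⟩ : ∃ k, d = k + 1 := ⟨d - 1, by omega⟩
  obtain ⟨c0, hc0, hmain⟩ := main_good δ k
  rw [Nat.add_sub_cancel]
  set e : ℝ := (3 : ℝ) - 1 / 2 ^ k with he
  have he0 : 0 < e := by
    have : (1 : ℝ) / 2 ^ k ≤ 1 := by
      rw [div_le_one (by positivity)]
      exact one_le_pow₀ (by norm_num)
    linarith
  set q : ℕ := 3 * δ + 1 with hq
  set D : ℝ := 2 * (q : ℝ) with hD
  have hq1 : (1 : ℝ) ≤ q := by rw [hq]; push_cast; linarith [(Nat.cast_nonneg δ : (0 : ℝ) ≤ δ)]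
  have hD0 : 0 < D := by positivity
  have hDe : 0 < D ^ e := Real.rpow_pos_of_pos hD0 e
  refine ⟨min c0 1 / D ^ e, div_pos (lt_min hc0 one_pos) hDe, ?_⟩
  intro u v hu hv hu' hv' n A hA
  change _ ≤ ((sumSet u A).card : ℝ) * ((prodSet v A).card : ℝ)
  rw [div_mul_eq_mul_div, div_le_iff₀ hDe]
  rcases Nat.eq_zero_or_pos n with hn | hn
  · rw [hn, Nat.cast_zero, Real.zero_rpow he0.ne', mul_zero]
    positivity
  have hne : (Fintype.piFinset A).Nonempty := by
    rw [Fintype.piFinset_nonempty]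
    intro i
    rw [← Finset.card_pos, hA i]
    exact hn
  rcases Nat.lt_or_ge n q with hnq | hnq
  · have h1 : 1 ≤ (sumSet u A).card := Finset.card_pos.mpr (hne.image _)
    have h2 : 1 ≤ (prodSet v A).card := Finset.card_pos.mpr (hne.image _)
    have h3 : (1 : ℝ) ≤ ((sumSet u A).card : ℝ) * ((prodSet v A).card : ℝ) := by
      exact_mod_cast Nat.mul_le_mul h1 h2
    have h4 : (n : ℝ) ≤ D := by
      have : (n : ℝ) ≤ q := by exact_mod_cast hnq.le
      linarith
    have h5 : (n : ℝ) ^ e ≤ D ^ e := Real.rpow_le_rpow (by positivity) h4 he0.le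
    have h6 : 0 ≤ (n : ℝ) ^ e := by positivity
    calc min c0 1 * (n : ℝ) ^ e ≤ 1 * D ^ e :=
          mul_le_mul (min_le_right _ _) h5 h6 zero_le_one
      _ ≤ _ := mul_le_mul_of_nonneg_right h3 hDe.le
  · set m := n / q with hm
    have hB : ∀ i, ∃ B ⊆ A i, Good (u i) (v i) B ∧ B.card = m := by
      intro i
      obtain ⟨B, hBA, hG, hc⟩ := exists_good (u i) (v i) δ (hu i) (hv i) (hu' i) (hv' i) (A i)
      rw [hA i, ← hq] at hc
      have hmB : m ≤ B.card := by
        rw [hm]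
        refine Nat.lt_succ_iff.mp ((Nat.div_lt_iff_lt_mul (by omega)).mpr ?_)
        have : (B.card).succ * q = q * B.card + q := by rw [Nat.succ_mul, mul_comm]
        omega
      obtain ⟨B', hB', hB'c⟩ := Finset.exists_subset_card_eq hmB
      exact ⟨B', hB'.trans hBA, good_subset hG hB', hB'c⟩
    choose B hBA hBG hBc using hB
    have h := hmain u v hu hv hu' hv' m B hBc hBG
    have hpi : Fintype.piFinset B ⊆ Fintype.piFinset A := Fintype.piFinset_subset _ _ hBA
    have s1 : (sumSet u B).card ≤ (sumSet u A).card :=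
      Finset.card_le_card (Finset.image_subset_image hpi)
    have s2 : (prodSet v B).card ≤ (prodSet v A).card :=
      Finset.card_le_card (Finset.image_subset_image hpi)
    have s3 : ((sumSet u B).card : ℝ) * ((prodSet v B).card : ℝ) ≤
        ((sumSet u A).card : ℝ) * ((prodSet v A).card : ℝ) := by
      exact_mod_cast Nat.mul_le_mul s1 s2
    have h4 : (n : ℝ) ≤ D * m := by
      have h5 : n ≤ 2 * q * m := by
        have h6 : 1 ≤ m := (Nat.one_le_div_iff (by omega)).mpr hnq
        have h7 := Nat.div_add_mod n q
        have h8 := Nat.mod_lt n (show q > 0 by omega)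
        rw [← hm] at h7
        nlinarith
      rw [hD]; exact_mod_cast h5
    have h5 : (n : ℝ) ^ e ≤ D ^ e * (m : ℝ) ^ e := by
      rw [← Real.mul_rpow hD0.le (by positivity)]
      exact Real.rpow_le_rpow (by positivity) h4 he0.le
    calc min c0 1 * (n : ℝ) ^ e ≤ c0 * (D ^ e * (m : ℝ) ^ e) :=
          mul_le_mul (min_le_left _ _) h5 (by positivity) hc0.le
      _ = (c0 * (m : ℝ) ^ e) * D ^ e := by ring
      _ ≤ _ := mul_le_mul_of_nonneg_right (h.trans s3) hDe.le
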